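/- There exists a family of linear operators S_t : C^∞(𝕋¹,ℂ) → C^∞(𝕋¹,ℂ), t ≥ 1, given by convolution S_t f = f ∗ φ_t with φ_t(x) = tφ(tx) and φ the inverse Fourier transform of a smooth even cutoff η supported in [−1,1] and equal to 1 on [−1/2,1/2], such that: (i) S_t f is a trigonometric polynomial of degree at most t (indeed S_t(e^{2πinθ}) = η(−n/t)e^{2πinθ}); and (ii) for every pair (k,n) ∈ ℕ² with k ≤ n there exist positive constants C_{k,n} such that for all f ∈ C^∞(𝕋¹,ℂ) and all t ≥ 1: ‖S_t f‖_n ≤ C_{k,n} t^{n−k} ‖f‖_k and ‖S_t f − f‖_k ≤ C_{k,n} t^{k−n} ‖f‖_n. -/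

import Mathlib

open MeasureTheory Metric Complex Real Set Function

noncomputable section

/-- Distance from a real number to the nearest integer. -/
def distInt (x : ℝ) : ℝ := ⨅ p : ℤ, |x - (p : ℝ)|

/-- The Diophantine condition CD on a real number. -/
def IsCD (α : ℝ) : Prop :=
  Irrational α ∧ ∃ c : ℝ, 0 < c ∧ ∃ τ : ℝ, 0 ≤ τ ∧
    ∀ N : ℕ, 1 ≤ N → c / (N : ℝ) ^ (1 + τ) ≤ distInt (N * α)

/-- The Diophantine condition CD₁ on a pair of real numbers. -/
def IsCD1 (α β : ℝ) : Prop :=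
  Irrational α ∧ ∃ c : ℝ, 0 < c ∧ ∃ τ : ℝ, 0 ≤ τ ∧
    (∀ N : ℕ, 1 ≤ N → c / (N : ℝ) ^ (1 + τ) ≤ distInt (N * α)) ∧
    (∀ N : ℤ, N ≠ 0 → c / |(N : ℝ)| ^ (1 + τ) ≤ distInt (N * α - β))

/-- The C^r norm of a smooth Banach-space-valued function on the circle. -/
def cNorm {E : Type*} [NormedAddCommGroup E] [NormedSpace ℝ E] (r : ℕ) (g : ℝ → E) : ℝ :=
  ∑ i ∈ Finset.range (r + 1), ⨆ θ : ℝ, ‖iteratedDeriv i g θ‖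

/-- C^∞ and ℤ-periodic : a smooth function on the circle 𝕋¹ = ℝ/ℤ. -/
def SmoothPer {E : Type*} [NormedAddCommGroup E] [NormedSpace ℝ E] (g : ℝ → E) : Prop :=
  ContDiff ℝ (⊤ : ℕ∞) g ∧ Function.Periodic g 1

/-- Fourier coefficients of a function on the circle. -/
def fourierCoef (φ : ℝ → ℂ) (n : ℤ) : ℂ :=
  ∫ θ in (0:ℝ)..1, φ θ * Complex.exp (-(2 * π * I * n * θ))

/-- The closed disc of radius r in ℂ. -/
abbrev OmDom (r : ℝ) : Set ℂ := Metric.closedBall (0 : ℂ) r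

instance (r : ℝ) : CompactSpace (OmDom r) :=
  isCompact_iff_compactSpace.mp (isCompact_closedBall (0:ℂ) r)

/-- The Banach space Ω(closure D(0,r)) realized as continuous functions on the closed disc
(holomorphy on the open disc is the predicate `HolOm`), with the sup norm. -/
abbrev Om (r : ℝ) := C(OmDom r, ℂ)

-- Evaluation of an element of Ω at a point of the closed disc (junk value outside).
open scoped Classical in
def evOm {r : ℝ} (g : Om r) (z : ℂ) : ℂ :=
  if h : z ∈ OmDom r then g ⟨z, h⟩ else 0

/-- Holomorphy on the open disc. -/
def HolOm {r : ℝ} (g : Om r) : Prop :=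
  DifferentiableOn ℂ (evOm g) (Metric.ball (0:ℂ) r)

/-- The model fiber map z ↦ e^{2πiβ} z as an element of Ω(closure 𝔻). -/
def lamMap (β : ℝ) : Om 1 :=
  ⟨fun z => Complex.exp (2 * π * I * β) * z.val, by fun_prop⟩

/-- `u` is a C^∞ curve with values in the open unit disc, invariant under the fibered
holomorphic dynamics F(θ,z) = (θ+α, f(θ,z)). -/
def IsInvCurve (α : ℝ) (f : ℝ → Om 1) (u : ℝ → ℂ) : Prop :=
  ContDiff ℝ (⊤ : ℕ∞) u ∧ Function.Periodic u 1 ∧ (∀ θ, ‖u θ‖ < 1) ∧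
    ∀ θ, evOm (f θ) (u θ) = u (θ + α)

/-- The curve `u` has degree zero (the derivative along the curve admits a continuous
logarithm ℓ on 𝕋¹), is indifferent (∫ log|∂_z f(θ,u(θ))| dθ = 0), and its transversal
rotation number (1/2πi)∫ ℓ is β mod 1. -/
def HasRotNum (β : ℝ) (f : ℝ → Om 1) (u : ℝ → ℂ) : Prop :=
  ∃ ℓ : ℝ → ℂ, Continuous ℓ ∧ Function.Periodic ℓ 1 ∧
    (∀ θ, Complex.exp (ℓ θ) = deriv (evOm (f θ)) (u θ)) ∧
    (∫ θ in (0:ℝ)..1, (ℓ θ).re) = 0 ∧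
    ∃ m : ℤ, (∫ θ in (0:ℝ)..1, ℓ θ) = 2 * π * I * (β + m)

/-- Smallest singular value of an ℝ-linear map ℂ → ℂ (ℂ ≅ ℝ²). -/
def minSv (A : ℂ →L[ℝ] ℂ) : ℝ := ⨅ v : Metric.sphere (0:ℂ) 1, ‖A v.val‖

end

/-- The function φ = inverse Fourier transform of the cutoff η. -/
noncomputable def invFT (η : ℝ → ℝ) (x : ℝ) : ℂ :=
  ∫ ξ : ℝ, Complex.exp (-(2 * Real.pi * Complex.I * ξ * x)) * (η ξ : ℂ)

/-- The smoothing operator S_t f = f ∗ φ_t, where φ_t(x) = tφ(tx). -/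
noncomputable def smOp (η : ℝ → ℝ) (t : ℝ) (f : ℝ → ℂ) (x : ℝ) : ℂ :=
  ∫ y : ℝ, f (x - y) * ((t : ℂ) * invFT η (t * y))

open scoped SchwartzMap FourierTransform

/-! ### Smooth periodic functions and their norms -/

section SmoothPeriodic

variable {E : Type*} [NormedAddCommGroup E] [NormedSpace ℝ E] {f : ℝ → E}

lemma SmoothPer.continuous (hf : SmoothPer f) : Continuous f := hf.1.continuous

lemma SmoothPer.hasDerivAt (hf : SmoothPer f) (x : ℝ) : HasDerivAt f (deriv f x) x :=
  ((hf.1.differentiable (by simp)) x).hasDerivAt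

lemma SmoothPer.deriv (hf : SmoothPer f) : SmoothPer (deriv f) := by
  refine ⟨(contDiff_infty_iff_deriv.1 hf.1).2, fun x => ?_⟩
  rw [← deriv_comp_add_const f 1 x]
  congr 1
  exact funext hf.2

lemma SmoothPer.iteratedDeriv (hf : SmoothPer f) (i : ℕ) : SmoothPer (iteratedDeriv i f) := by
  induction i with
  | zero => simpa using hf
  | succ i ih => rw [iteratedDeriv_succ]; exact ih.deriv

lemma SmoothPer.exists_norm_le (hf : SmoothPer f) : ∃ M, ∀ x, ‖f x‖ ≤ M := by
  obtain ⟨M, hM⟩ := (hf.2.isBounded_of_continuous one_ne_zero hf.continuous).exists_norm_le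
  exact ⟨M, fun x => hM _ (mem_range_self x)⟩

lemma SmoothPer.bddAbove_norm (hf : SmoothPer f) : BddAbove (range fun θ => ‖f θ‖) := by
  obtain ⟨M, hM⟩ := hf.exists_norm_le
  exact ⟨M, by rintro _ ⟨x, rfl⟩; exact hM x⟩

lemma SmoothPer.norm_iteratedDeriv_le_cNorm (hf : SmoothPer f) {i r : ℕ} (hi : i ≤ r) (x : ℝ) :
    ‖_root_.iteratedDeriv i f x‖ ≤ cNorm r f :=
  (le_ciSup (hf.iteratedDeriv i).bddAbove_norm x).trans <|
    Finset.single_le_sum (f := fun i => ⨆ θ : ℝ, ‖_root_.iteratedDeriv i f θ‖)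
      (fun _ _ => Real.iSup_nonneg fun _ => norm_nonneg _) (Finset.mem_range.2 (by omega))

lemma cNorm_nonneg (r : ℕ) (f : ℝ → E) : 0 ≤ cNorm r f :=
  Finset.sum_nonneg fun _ _ => Real.iSup_nonneg fun _ => norm_nonneg _

lemma cNorm_le_of_forall_le {r : ℕ} {K : ℝ}
    (h : ∀ i ≤ r, ∀ x, ‖iteratedDeriv i f x‖ ≤ K) : cNorm r f ≤ (r + 1) * K := by
  have := Finset.sum_le_card_nsmul (Finset.range (r + 1))
    (fun i => ⨆ θ : ℝ, ‖iteratedDeriv i f θ‖) K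
    (fun i hi => ciSup_le (h i (by simpa [Nat.lt_succ_iff] using hi)))
  simpa [cNorm] using this

/-- Taylor's estimate with a global bound on the derivative of order `m`. -/
lemma norm_sub_taylor_sum_le (m : ℕ) {f : ℝ → E} (hf : ContDiff ℝ (⊤ : ℕ∞) f) {C : ℝ}
    (hC : ∀ x, ‖iteratedDeriv m f x‖ ≤ C) (a s : ℝ) :
    ‖f (a + s) - ∑ j ∈ Finset.range m, (s ^ j / j.factorial) • iteratedDeriv j f a‖
      ≤ C * |s| ^ m := by
  induction m generalizing f s with
  | zero => simpa using hC (a + s)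
  | succ m ih =>
    have hd : ContDiff ℝ (⊤ : ℕ∞) (deriv f) := (contDiff_infty_iff_deriv.1 hf).2
    have ih' := ih hd (fun x => by rw [← iteratedDeriv_succ']; exact hC x)
    have hC0 : 0 ≤ C := (norm_nonneg _).trans (hC 0)
    set R : ℝ → E := fun s => f (a + s) -
      ∑ j ∈ Finset.range (m + 1), (s ^ j / j.factorial) • iteratedDeriv j f a with hR
    have hderiv (y : ℝ) : HasDerivAt R (deriv f (a + y) -
        ∑ j ∈ Finset.range m, (y ^ j / j.factorial) • iteratedDeriv j (deriv f) a) y := by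
      have h1 : HasDerivAt (fun s => f (a + s)) (deriv f (a + y)) y := by
        simpa using (((hf.differentiable (by simp)) (a + y)).hasDerivAt.comp_const_add a y)
      have h2 : HasDerivAt (fun s : ℝ => ∑ j ∈ Finset.range (m + 1),
          (s ^ j / j.factorial) • iteratedDeriv j f a)
          (∑ j ∈ Finset.range (m + 1),
            ((j : ℝ) * y ^ (j - 1) / j.factorial) • iteratedDeriv j f a) y :=
        HasDerivAt.fun_sum fun j _ =>
          ((hasDerivAt_pow j y).div_const _).smul_const _
      refine (h1.sub h2).congr_deriv ?_
      rw [Finset.sum_range_succ']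
      simp only [Nat.cast_zero, zero_mul, zero_div, zero_smul, add_zero, iteratedDeriv_succ']
      congr 1
      refine Finset.sum_congr rfl fun j _ => ?_
      congr 1
      rw [Nat.factorial_succ]
      push_cast
      have : (j : ℝ) + 1 ≠ 0 := by positivity
      field_simp
    have hR0 : R 0 = 0 := by
      simp [hR, Finset.sum_range_succ']
    have := (convex_segment (0 : ℝ) s).norm_image_sub_le_of_norm_hasDerivWithin_le
      (f := R) (C := C * |s| ^ m)
      (fun y _ => (hderiv y).hasDerivWithinAt) (fun y hy => (ih' y).trans ?_)
      (left_mem_segment ℝ 0 s) (right_mem_segment ℝ 0 s)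
    · rw [hR0, sub_zero, sub_zero, Real.norm_eq_abs, mul_assoc, ← pow_succ] at this
      exact this
    · refine mul_le_mul_of_nonneg_left (pow_le_pow_left₀ (abs_nonneg y) ?_ m) hC0
      rw [segment_eq_uIcc] at hy
      simpa using abs_sub_left_of_mem_uIcc hy

end SmoothPeriodic

/-! ### Averages of translates against a Schwartz function -/

section ScaledConv

/-- The convolution of `f` with the dilation `x ↦ t ψ(t x)`, written after rescaling. -/
noncomputable def scaledConv (ψ : 𝓢(ℝ, ℂ)) (t : ℝ) (f : ℝ → ℂ) (x : ℝ) : ℂ :=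
  ∫ u : ℝ, f (x - u / t) * ψ u

variable {ψ : 𝓢(ℝ, ℂ)} {t : ℝ} {f : ℝ → ℂ}

lemma integrable_scaledConv (hf : SmoothPer f) (x : ℝ) :
    Integrable fun u : ℝ => f (x - u / t) * ψ u := by
  obtain ⟨M, hM⟩ := hf.exists_norm_le
  exact ψ.integrable.bdd_mul (c := M)
    (hf.continuous.comp (by fun_prop)).aestronglyMeasurable (ae_of_all _ fun _ => hM _)

lemma norm_scaledConv_le {M : ℝ} (hM : ∀ x, ‖f x‖ ≤ M) (x : ℝ) :
    ‖scaledConv ψ t f x‖ ≤ M * ∫ u, ‖ψ u‖ := by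
  rw [← integral_const_mul]
  refine norm_integral_le_of_norm_le (ψ.integrable.norm.const_mul M) (ae_of_all _ fun u => ?_)
  rw [norm_mul]
  gcongr
  exact hM _

lemma hasDerivAt_scaledConv (hf : SmoothPer f) (x : ℝ) :
    HasDerivAt (scaledConv ψ t f) (scaledConv ψ t (deriv f) x) x := by
  obtain ⟨M, hM⟩ := hf.deriv.exists_norm_le
  refine (hasDerivAt_integral_of_dominated_loc_of_deriv_le (bound := fun u => M * ‖ψ u‖)
    (F' := fun x u => deriv f (x - u / t) * ψ u) Filter.univ_mem
    (Filter.Eventually.of_forall fun x => (integrable_scaledConv hf x).aestronglyMeasurable)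
    (integrable_scaledConv hf x) (integrable_scaledConv hf.deriv x).aestronglyMeasurable
    (ae_of_all _ fun u y _ => ?_) (ψ.integrable.norm.const_mul M)
    (ae_of_all _ fun u y _ => ?_)).2
  · rw [norm_mul]
    gcongr
    exact hM _
  · exact ((hf.hasDerivAt (y - u / t)).comp_sub_const y (u / t)).mul_const _

lemma iteratedDeriv_scaledConv (hf : SmoothPer f) (i : ℕ) :
    iteratedDeriv i (scaledConv ψ t f) = scaledConv ψ t (iteratedDeriv i f) := by
  induction i with
  | zero => simp
  | succ i ih =>
    rw [iteratedDeriv_succ, ih, iteratedDeriv_succ]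
    exact funext fun x => (hasDerivAt_scaledConv (hf.iteratedDeriv i) x).deriv

lemma SmoothPer.scaledConv (hf : SmoothPer f) : SmoothPer (scaledConv ψ t f) := by
  refine ⟨contDiff_of_differentiable_iteratedDeriv fun i _ => ?_, fun x => ?_⟩
  · rw [iteratedDeriv_scaledConv hf]
    exact fun x => (hasDerivAt_scaledConv (hf.iteratedDeriv i) x).differentiableAt
  · refine integral_congr_ae (ae_of_all _ fun u => ?_)
    simp only
    rw [add_sub_right_comm, hf.2]

/-- Integration by parts moves a derivative onto the Schwartz function. -/
lemma scaledConv_deriv (ht : t ≠ 0) (hf : SmoothPer f) (x : ℝ) :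
    scaledConv ψ t (deriv f) x = t * scaledConv (SchwartzMap.derivCLM ℂ ℂ ψ) t f x := by
  have htc : (t : ℂ) ≠ 0 := by exact_mod_cast ht
  have hu (u : ℝ) : HasDerivAt (fun u : ℝ => f (x - u / t))
      (-(t : ℂ)⁻¹ * deriv f (x - u / t)) u := by
    have h := (hf.hasDerivAt (x - u / t)).scomp u (((hasDerivAt_id u).div_const t).const_sub x)
    refine h.congr_deriv ?_
    simp [Complex.real_smul]
  have key := integral_mul_deriv_eq_deriv_mul_of_integrable
    (u := fun u : ℝ => f (x - u / t)) (v := ψ) (fun u _ => hu u) (fun u _ => ψ.hasDerivAt u)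
    (integrable_scaledConv (ψ := SchwartzMap.derivCLM ℂ ℂ ψ) hf x)
    (((integrable_scaledConv (ψ := ψ) hf.deriv x).const_mul (-(t : ℂ)⁻¹)).congr
      (ae_of_all _ fun u => (mul_assoc _ _ _).symm))
    (integrable_scaledConv hf x)
  simp only [mul_assoc, integral_const_mul] at key
  have : scaledConv (SchwartzMap.derivCLM ℂ ℂ ψ) t f x = (t : ℂ)⁻¹ * scaledConv ψ t (deriv f) x := by
    simp only [scaledConv, SchwartzMap.derivCLM_apply]
    rw [key]
    ring
  rw [this, mul_inv_cancel_left₀ htc]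

lemma scaledConv_iteratedDeriv (ht : t ≠ 0) (hf : SmoothPer f) (j : ℕ) (x : ℝ) :
    scaledConv ψ t (iteratedDeriv j f) x
      = (t : ℂ) ^ j * scaledConv ((SchwartzMap.derivCLM ℂ ℂ)^[j] ψ) t f x := by
  induction j generalizing ψ with
  | zero => simp
  | succ j ih =>
    rw [iteratedDeriv_succ, scaledConv_deriv ht (hf.iteratedDeriv j), ih,
      Function.iterate_succ_apply]
    ring

/-- Convolution with a dilation of a Schwartz function of total mass one whose higher moments
vanish approximates smooth functions to every order. -/
lemma norm_scaledConv_sub_self_le (h0 : ∫ u, ψ u = 1)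
    (hmom : ∀ j : ℕ, j ≠ 0 → ∫ u : ℝ, (u : ℂ) ^ j * ψ u = 0) (ht : 0 < t) (hf : SmoothPer f)
    (m : ℕ) {C : ℝ} (hC : ∀ x, ‖iteratedDeriv m f x‖ ≤ C) (x : ℝ) :
    ‖scaledConv ψ t f x - f x‖ ≤ (1 + ∫ u, |u| ^ m * ‖ψ u‖) * t⁻¹ ^ m * C := by
  have hC0 : 0 ≤ C := (norm_nonneg _).trans (hC 0)
  rcases Nat.eq_zero_or_pos m with rfl | hm
  · have hC' : ∀ x, ‖f x‖ ≤ C := by simpa using hC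
    have h1 := norm_sub_le (scaledConv ψ t f x) (f x)
    have h2 := norm_scaledConv_le (ψ := ψ) (t := t) hC' x
    have h3 := hC' x
    simp only [pow_zero, one_mul, mul_one]
    linarith
  have hint (j : ℕ) : Integrable fun u : ℝ => (u : ℂ) ^ j * ψ u := by
    refine (integrable_norm_iff ?_).1 ((ψ.integrable_pow_mul volume j).congr
      (ae_of_all _ fun u => by simp))
    exact ((by fun_prop : Continuous fun u : ℝ => (u : ℂ) ^ j).mul
      ψ.continuous).aestronglyMeasurable
  set T : ℝ → ℂ := fun u => ∑ j ∈ Finset.range m,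
    ((-(u / t)) ^ j / j.factorial) • iteratedDeriv j f x with hT
  have hTψ (u : ℝ) : T u * ψ u = ∑ j ∈ Finset.range m,
      (((-(t : ℂ)⁻¹) ^ j / j.factorial) * iteratedDeriv j f x) * ((u : ℂ) ^ j * ψ u) := by
    rw [hT, Finset.sum_mul]
    refine Finset.sum_congr rfl fun j _ => ?_
    rw [Complex.real_smul]
    push_cast
    rw [div_eq_mul_inv (u : ℂ), ← mul_neg, mul_pow]
    ring
  have hTint : Integrable fun u => T u * ψ u := by
    simp_rw [hTψ]
    exact integrable_finsetSum _ fun j _ => (hint j).const_mul _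
  have hTval : ∫ u, T u * ψ u = f x := by
    simp_rw [hTψ]
    rw [integral_finsetSum _ fun j _ => (hint j).const_mul _]
    simp_rw [integral_const_mul]
    rw [Finset.sum_eq_single_of_mem 0 (Finset.mem_range.2 hm)
      (fun j _ hj => by rw [hmom j hj, mul_zero])]
    simp [h0]
  have hmint : Integrable fun u : ℝ => |u| ^ m * ‖ψ u‖ := ψ.integrable_pow_mul volume m
  have hle : ‖scaledConv ψ t f x - f x‖ ≤ ∫ u, (t⁻¹ ^ m * C) * (|u| ^ m * ‖ψ u‖) := by
    rw [← hTval, scaledConv, ← integral_sub (integrable_scaledConv hf x) hTint]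
    refine norm_integral_le_of_norm_le (hmint.const_mul _) (ae_of_all _ fun u => ?_)
    rw [← sub_mul, norm_mul]
    have h := norm_sub_taylor_sum_le m hf.1 hC x (-(u / t))
    rw [← sub_eq_add_neg, abs_neg, abs_div, abs_of_pos ht, div_eq_mul_inv |u|, mul_pow] at h
    calc _ ≤ C * (|u| ^ m * t⁻¹ ^ m) * ‖ψ u‖ := by gcongr
      _ = _ := by ring
  rw [integral_const_mul] at hle
  refine hle.trans ?_
  have : 0 ≤ t⁻¹ ^ m * C := by positivity
  nlinarith

end ScaledConv

/-! ### Characters and Fourier coefficients -/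

section Characters

variable {ψ : 𝓢(ℝ, ℂ)} {t : ℝ} {f : ℝ → ℂ}

lemma scaledConv_exp (n : ℤ) (x : ℝ) :
    scaledConv ψ t (fun θ => Complex.exp (2 * π * I * n * θ)) x
      = 𝓕 (ψ : ℝ → ℂ) (n / t) * Complex.exp (2 * π * I * n * x) := by
  rw [scaledConv, Real.fourier_real_eq_integral_exp_smul, ← integral_mul_const]
  refine integral_congr_ae (ae_of_all _ fun u => ?_)
  simp only [smul_eq_mul]
  rw [mul_right_comm _ (ψ u), ← Complex.exp_add]
  congr 2
  push_cast
  ring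

lemma fourierCoef_scaledConv (hf : SmoothPer f) (n : ℤ) :
    fourierCoef (scaledConv ψ t f) n = 𝓕 (ψ : ℝ → ℂ) (n / t) * fourierCoef f n := by
  obtain ⟨M, hM⟩ := hf.exists_norm_le
  set e : ℝ → ℂ := fun θ => Complex.exp (-(2 * π * I * n * θ)) with he
  have he_add (a b : ℝ) : e (a + b) = e a * e b := by
    simp only [he, ← Complex.exp_add]
    congr 1
    push_cast
    ring
  have he_norm (a : ℝ) : ‖e a‖ = 1 := by
    rw [he, Complex.norm_exp]
    simp
  have he_per : Periodic e 1 := fun x => by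
    have : e 1 = 1 := by
      simp only [he]
      rw [← Complex.exp_int_mul_two_pi_mul_I (-n)]
      congr 1
      push_cast
      ring
    rw [he_add, this, mul_one]
  have he_cont : Continuous e := by fun_prop
  have hinner (u : ℝ) : ∫ x in (0 : ℝ)..1, f (x - u / t) * ψ u * e x
      = fourierCoef f n * (e (u / t) * ψ u) := by
    have hsub : ∫ x in (0 : ℝ)..1, f (x - u / t) * e (x - u / t) = fourierCoef f n := by
      rw [intervalIntegral.integral_comp_sub_right (fun x => f x * e x)]
      have := (hf.2.mul he_per).intervalIntegral_add_eq (0 - u / t) 0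
      rw [zero_add, sub_add_eq_add_sub, zero_add] at this
      exact this
    rw [← hsub, ← intervalIntegral.integral_mul_const]
    refine intervalIntegral.integral_congr fun x _ => ?_
    rw [show e x = e (x - u / t) * e (u / t) by rw [← he_add, sub_add_cancel]]
    ring
  have hint : Integrable (uncurry fun x u => f (x - u / t) * ψ u * e x)
      ((volume.restrict (Ioc (0 : ℝ) 1)).prod volume) := by
    have h := (integrable_const (μ := volume.restrict (Ioc (0 : ℝ) 1)) (1 : ℂ)).mul_prod
      (ψ.integrable (μ := volume))
    have hc := hf.continuous
    refine (h.bdd_mul (f := fun p : ℝ × ℝ => f (p.1 - p.2 / t) * e p.1) (c := M)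
      (by fun_prop : Continuous fun p : ℝ × ℝ => f (p.1 - p.2 / t) * e p.1).aestronglyMeasurable
      (ae_of_all _ fun p => by rw [norm_mul, he_norm, mul_one]; exact hM _)).congr
      (ae_of_all _ fun p => ?_)
    simp only [uncurry]
    ring
  calc fourierCoef (scaledConv ψ t f) n
      = ∫ x in Ioc (0 : ℝ) 1, ∫ u, f (x - u / t) * ψ u * e x := by
        rw [fourierCoef, intervalIntegral.integral_of_le zero_le_one]
        simp_rw [integral_mul_const]
        rfl
    _ = ∫ u, ∫ x in Ioc (0 : ℝ) 1, f (x - u / t) * ψ u * e x := integral_integral_swap hint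
    _ = ∫ u, fourierCoef f n * (e (u / t) * ψ u) := by
        simp_rw [← intervalIntegral.integral_of_le zero_le_one, hinner]
    _ = _ := by
        rw [integral_const_mul, mul_comm, Real.fourier_real_eq_integral_exp_smul]
        congr 1
        refine integral_congr_ae (ae_of_all _ fun u => ?_)
        simp only [he, smul_eq_mul]
        congr 2
        push_cast
        ring

/-- A continuous periodic function with finitely many nonzero Fourier coefficients is a
trigonometric polynomial. -/
lemma eq_sum_fourierCoef (hc : Continuous f) (hp : Periodic f 1) {s : Finset ℤ}
    (hs : ∀ n ∉ s, fourierCoef f n = 0) (x : ℝ) :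
    f x = ∑ n ∈ s, fourierCoef f n * Complex.exp (2 * π * I * n * x) := by
  have : Fact ((0 : ℝ) < 1) := ⟨one_pos⟩
  let F : C(AddCircle (1 : ℝ), ℂ) := ⟨hp.lift, continuous_coinduced_dom.mpr hc⟩
  have hF (y : ℝ) : F (y : AddCircle (1 : ℝ)) = f y := hp.lift_coe y
  have hcoef (n : ℤ) : fourierCoeff F n = fourierCoef f n := by
    rw [fourierCoeff_eq_intervalIntegral F n 0, fourierCoef, zero_add, div_one, one_smul]
    refine intervalIntegral.integral_congr fun y _ => ?_
    simp only [hF, fourier_coe_apply, smul_eq_mul]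
    rw [mul_comm]
    congr 2
    push_cast
    ring
  have hsupp : ∀ n ∉ s, fourierCoeff F n = 0 := fun n hn => by rw [hcoef, hs n hn]
  have h := has_pointwise_sum_fourier_series_of_summable
    (summable_of_ne_finset_zero hsupp) (x : AddCircle (1 : ℝ))
  rw [hF] at h
  rw [h.unique (hasSum_sum_of_ne_finset_zero fun n hn => by rw [hsupp n hn, zero_smul])]
  refine Finset.sum_congr rfl fun n _ => ?_
  rw [hcoef, fourier_coe_apply, smul_eq_mul]
  simp

end Characters

/-! ### The cutoff -/

/-- A smooth even cutoff, equal to `1` on `[-1/2, 1/2]` and supported in `[-1, 1]`. -/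
noncomputable def evenCutoff : ContDiffBump (0 : ℝ) := ⟨1 / 2, 1, by norm_num, by norm_num⟩

/-- The cutoff as a complex-valued Schwartz function. -/
noncomputable def evenCutoffSchwartz : 𝓢(ℝ, ℂ) :=
  HasCompactSupport.toSchwartzMap (f := fun x : ℝ => (evenCutoff x : ℂ))
    (evenCutoff.hasCompactSupport.comp_left Complex.ofReal_zero)
    (Complex.ofRealCLM.contDiff.comp evenCutoff.contDiff)

lemma evenCutoff_neg (x : ℝ) : evenCutoff (-x) = evenCutoff x := evenCutoff.neg x

lemma evenCutoff_eq_one {x : ℝ} (hx : |x| ≤ 1 / 2) : evenCutoff x = 1 :=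
  evenCutoff.one_of_mem_closedBall (by simpa [evenCutoff] using hx)

lemma evenCutoff_eq_zero {x : ℝ} (hx : 1 ≤ |x|) : evenCutoff x = 0 :=
  evenCutoff.zero_of_le_dist (by simpa [evenCutoff] using hx)

lemma evenCutoffSchwartz_apply (x : ℝ) : evenCutoffSchwartz x = (evenCutoff x : ℂ) := rfl

lemma invFT_evenCutoff (x : ℝ) : invFT evenCutoff x = (𝓕 evenCutoffSchwartz) x := by
  rw [SchwartzMap.fourier_coe, Real.fourier_real_eq_integral_exp_smul, invFT]
  refine integral_congr_ae (ae_of_all _ fun u => ?_)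
  simp only [smul_eq_mul, evenCutoffSchwartz_apply]
  congr 2
  push_cast
  ring

lemma fourier_fourier_evenCutoff (x : ℝ) :
    𝓕 ((𝓕 evenCutoffSchwartz : 𝓢(ℝ, ℂ)) : ℝ → ℂ) x = (evenCutoff x : ℂ) := by
  have h : 𝓕⁻ (𝓕 evenCutoffSchwartz) = evenCutoffSchwartz := FourierTransform.fourierInv_fourier_eq _
  have h2 := congrArg (fun g : 𝓢(ℝ, ℂ) => g (-x)) h
  simp only [SchwartzMap.fourierInv_coe, Real.fourierInv_eq_fourier_neg, neg_neg,
    evenCutoffSchwartz_apply, evenCutoff_neg] at h2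
  exact h2

lemma integral_pow_mul_fourier_evenCutoff (j : ℕ) :
    ∫ u : ℝ, (u : ℂ) ^ j * (𝓕 evenCutoffSchwartz : 𝓢(ℝ, ℂ)) u = if j = 0 then 1 else 0 := by
  set φ : 𝓢(ℝ, ℂ) := 𝓕 evenCutoffSchwartz
  have hint (n : ℕ) : Integrable fun u : ℝ => u ^ n • φ u := by
    refine (integrable_norm_iff ?_).1 ((φ.integrable_pow_mul volume n).congr
      (ae_of_all _ fun u => by simp))
    exact ((by fun_prop : Continuous fun u : ℝ => u ^ n).smul φ.continuous).aestronglyMeasurable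
  have h1 : iteratedDeriv j (𝓕 (φ : ℝ → ℂ)) 0 = (-2 * π * I) ^ j * ∫ u : ℝ, (u : ℂ) ^ j * φ u := by
    rw [Real.iteratedDeriv_fourier (N := ⊤) (fun n _ => hint n) le_top,
      Real.fourier_real_eq_integral_exp_smul, ← integral_const_mul]
    refine integral_congr_ae (ae_of_all _ fun u => ?_)
    simp only [mul_zero, zero_mul, Complex.ofReal_zero, Complex.exp_zero, one_mul, smul_eq_mul,
      mul_pow, mul_assoc]
  have h2 : 𝓕 (φ : ℝ → ℂ) =ᶠ[nhds 0] fun _ => (1 : ℂ) := by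
    filter_upwards [Metric.ball_mem_nhds (0 : ℝ) (ε := 1 / 2) (by norm_num)] with x hx
    rw [fourier_fourier_evenCutoff, evenCutoff_eq_one (by simpa using (mem_ball_zero_iff.1 hx).le),
      Complex.ofReal_one]
  rw [h2.iteratedDeriv_eq, iteratedDeriv_const] at h1
  have hne : (-2 * π * I : ℂ) ^ j ≠ 0 := pow_ne_zero _ (by simp [Real.pi_ne_zero])
  split_ifs with hj
  · subst hj
    simpa using h1.symm
  · rw [if_neg hj] at h1
    exact (mul_eq_zero.1 h1.symm).resolve_left hne

lemma smOp_evenCutoff {t : ℝ} (ht : 0 < t) (f : ℝ → ℂ) :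
    smOp evenCutoff t f = scaledConv (𝓕 evenCutoffSchwartz) t f := by
  funext x
  have h := Measure.integral_comp_mul_left
    (fun u : ℝ => f (x - u / t) * (t * (𝓕 evenCutoffSchwartz : 𝓢(ℝ, ℂ)) u)) t
  simp only [mul_div_cancel_left₀ _ ht.ne'] at h
  simp only [smOp, scaledConv, invFT_evenCutoff]
  rw [h, abs_of_pos (inv_pos.2 ht), ← integral_smul]
  refine integral_congr_ae (ae_of_all _ fun u => ?_)
  have : (t : ℂ) ≠ 0 := by exact_mod_cast ht.ne'
  simp only [Complex.real_smul]
  push_cast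
  field_simp

/-! ### The norm estimates -/

section Estimates

variable {t : ℝ} {f : ℝ → ℂ}

lemma cNorm_scaledConv_le (ψ : 𝓢(ℝ, ℂ)) (ht : 1 ≤ t) (hf : SmoothPer f) {k n : ℕ} (hkn : k ≤ n) :
    cNorm n (scaledConv ψ t f) ≤
      (n + 1) * ((∑ j ∈ Finset.range (n + 1), ∫ u, ‖((SchwartzMap.derivCLM ℂ ℂ)^[j] ψ) u‖)
        * t ^ (n - k) * cNorm k f) := by
  refine cNorm_le_of_forall_le fun i hi x => ?_
  have ht0 : t ≠ 0 := by positivity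
  have hsplit : iteratedDeriv i f = iteratedDeriv (i - k) (iteratedDeriv (min i k) f) := by
    rw [iteratedDeriv_eq_iterate, iteratedDeriv_eq_iterate, iteratedDeriv_eq_iterate,
      ← Function.iterate_add_apply]
    congr 2
    omega
  rw [iteratedDeriv_scaledConv hf, hsplit, scaledConv_iteratedDeriv ht0 (hf.iteratedDeriv _),
    norm_mul, norm_pow, Complex.norm_real, Real.norm_of_nonneg (by positivity)]
  have hA : ∫ u, ‖((SchwartzMap.derivCLM ℂ ℂ)^[i - k] ψ) u‖ ≤
      ∑ j ∈ Finset.range (n + 1), ∫ u, ‖((SchwartzMap.derivCLM ℂ ℂ)^[j] ψ) u‖ :=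
    Finset.single_le_sum (f := fun j => ∫ u, ‖((SchwartzMap.derivCLM ℂ ℂ)^[j] ψ) u‖)
      (fun _ _ => integral_nonneg fun _ => norm_nonneg _) (Finset.mem_range.2 (by omega))
  have hA0 : 0 ≤ ∫ u, ‖((SchwartzMap.derivCLM ℂ ℂ)^[i - k] ψ) u‖ :=
    integral_nonneg fun _ => norm_nonneg _
  have hc := cNorm_nonneg k f
  calc _ ≤ t ^ (i - k) * (cNorm k f * ∫ u, ‖((SchwartzMap.derivCLM ℂ ℂ)^[i - k] ψ) u‖) := by
        gcongr
        exact norm_scaledConv_le (fun y => hf.norm_iteratedDeriv_le_cNorm (min_le_right i k) y) x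
    _ ≤ t ^ (n - k) * (cNorm k f *
          ∑ j ∈ Finset.range (n + 1), ∫ u, ‖((SchwartzMap.derivCLM ℂ ℂ)^[j] ψ) u‖) := by
        gcongr
    _ = _ := by ring

lemma cNorm_scaledConv_sub_self_le {ψ : 𝓢(ℝ, ℂ)} (h0 : ∫ u, ψ u = 1)
    (hmom : ∀ j : ℕ, j ≠ 0 → ∫ u : ℝ, (u : ℂ) ^ j * ψ u = 0) (ht : 0 < t) (hf : SmoothPer f)
    {k n : ℕ} (hkn : k ≤ n) :
    cNorm k (fun x => scaledConv ψ t f x - f x) ≤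
      (k + 1) * ((1 + ∫ u, |u| ^ (n - k) * ‖ψ u‖) * t⁻¹ ^ (n - k) * cNorm n f) := by
  refine cNorm_le_of_forall_le fun i hi x => ?_
  have hsub : iteratedDeriv i (fun x => scaledConv ψ t f x - f x) x
      = scaledConv ψ t (iteratedDeriv i f) x - iteratedDeriv i f x := by
    rw [iteratedDeriv_fun_sub, iteratedDeriv_scaledConv hf]
    · exact (hf.scaledConv.1.of_le (by exact_mod_cast le_top)).contDiffAt
    · exact (hf.1.of_le (by exact_mod_cast le_top)).contDiffAt
  rw [hsub]
  refine norm_scaledConv_sub_self_le h0 hmom ht (hf.iteratedDeriv i) (n - k) (fun y => ?_) x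
  have : iteratedDeriv (n - k) (iteratedDeriv i f) = iteratedDeriv (n - k + i) f := by
    rw [iteratedDeriv_eq_iterate, iteratedDeriv_eq_iterate, iteratedDeriv_eq_iterate,
      ← Function.iterate_add_apply]
  rw [this]
  exact hf.norm_iteratedDeriv_le_cNorm (by omega) y

end Estimates

/-- existence of the family of smoothing and approximation operators S_t on
C^∞(𝕋¹,ℂ), given by convolution with the dilated inverse Fourier transform of a smooth even
cutoff: eigenrelation on characters, trigonometric-polynomial range of degree ≤ t, and the
smoothing/approximation estimates. -/
theorem smoothing_operators_exist :
    ∃ η : ℝ → ℝ, ContDiff ℝ (⊤ : ℕ∞) η ∧ (∀ x, η (-x) = η x) ∧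
      Function.support η ⊆ Set.Icc (-1 : ℝ) 1 ∧
      (∀ x : ℝ, |x| ≤ 1 / 2 → η x = 1) ∧
      (∀ t : ℝ, 1 ≤ t → ∀ n : ℤ, ∀ x : ℝ,
        smOp η t (fun θ => Complex.exp (2 * π * I * n * θ)) x
          = (η (-(n : ℝ) / t) : ℂ) * Complex.exp (2 * π * I * n * x)) ∧
      (∀ t : ℝ, 1 ≤ t → ∀ f : ℝ → ℂ, SmoothPer f →
        SmoothPer (smOp η t f) ∧
        ∃ c : ℤ → ℂ, (∀ n : ℤ, t < |(n : ℝ)| → c n = 0) ∧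
          ∀ x : ℝ, smOp η t f x
            = ∑ n ∈ Finset.Icc (-⌊t⌋) ⌊t⌋, c n * Complex.exp (2 * π * I * n * x)) ∧
      (∀ k n : ℕ, k ≤ n → ∃ C : ℝ, 0 < C ∧
        ∀ f : ℝ → ℂ, SmoothPer f → ∀ t : ℝ, 1 ≤ t →
          cNorm n (smOp η t f) ≤ C * t ^ ((n : ℝ) - (k : ℝ)) * cNorm k f ∧
          cNorm k (fun x => smOp η t f x - f x) ≤ C * t ^ ((k : ℝ) - (n : ℝ)) * cNorm n f) := by
  refine ⟨evenCutoff, evenCutoff.contDiff, evenCutoff_neg, ?_, fun x hx => evenCutoff_eq_one hx,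
    fun t ht n x => ?_, fun t ht f hf => ?_, fun k n hkn => ?_⟩
  · intro x hx
    by_contra h
    exact hx (evenCutoff_eq_zero (not_le.1 (mt abs_le.1 h)).le)
  · rw [smOp_evenCutoff (by positivity), scaledConv_exp, fourier_fourier_evenCutoff, neg_div,
      evenCutoff_neg]
  · rw [smOp_evenCutoff (by positivity)]
    have hS : SmoothPer (scaledConv (𝓕 evenCutoffSchwartz) t f) := hf.scaledConv
    have hzero (n : ℤ) (hn : t < |(n : ℝ)|) :
        fourierCoef (scaledConv (𝓕 evenCutoffSchwartz) t f) n = 0 := by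
      have ht0 : 0 < t := by positivity
      rw [fourierCoef_scaledConv hf, fourier_fourier_evenCutoff, evenCutoff_eq_zero,
        Complex.ofReal_zero, zero_mul]
      rw [abs_div, abs_of_pos ht0, one_le_div ht0]
      exact hn.le
    refine ⟨hS, fourierCoef (scaledConv (𝓕 evenCutoffSchwartz) t f), hzero, ?_⟩
    refine eq_sum_fourierCoef hS.continuous hS.2 fun n hn => hzero n ?_
    rw [Finset.mem_Icc, ← abs_le, Int.le_floor, not_le] at hn
    exact_mod_cast hn
  · set A : ℝ := ∑ j ∈ Finset.range (n + 1),
      ∫ u, ‖((SchwartzMap.derivCLM ℂ ℂ)^[j] (𝓕 evenCutoffSchwartz)) u‖ with hA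
    set B : ℝ := 1 + ∫ u, |u| ^ (n - k) * ‖(𝓕 evenCutoffSchwartz : 𝓢(ℝ, ℂ)) u‖ with hB
    have hA0 : 0 ≤ A := Finset.sum_nonneg fun _ _ => integral_nonneg fun _ => norm_nonneg _
    have hB0 : 0 < B := add_pos_of_pos_of_nonneg one_pos (integral_nonneg fun _ => by positivity)
    refine ⟨(n + 1) * A + (k + 1) * B, by positivity, fun f hf t ht => ?_⟩
    have ht0 : 0 < t := by positivity
    have hpow : t ^ ((n : ℝ) - (k : ℝ)) = t ^ (n - k) := by
      rw [← Nat.cast_sub hkn, Real.rpow_natCast]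
    have hpow' : t ^ ((k : ℝ) - (n : ℝ)) = t⁻¹ ^ (n - k) := by
      rw [← neg_sub, Real.rpow_neg ht0.le, hpow, inv_pow]
    have hk := cNorm_nonneg k f
    have hn := cNorm_nonneg n f
    rw [smOp_evenCutoff ht0, hpow, hpow']
    constructor
    · refine (cNorm_scaledConv_le _ ht hf hkn).trans ?_
      rw [← hA, ← mul_assoc, ← mul_assoc]
      gcongr
      exact le_add_of_nonneg_right (by positivity)
    · refine (cNorm_scaledConv_sub_self_le
        (by simpa using integral_pow_mul_fourier_evenCutoff 0)
        (fun j hj => by simpa [hj] using integral_pow_mul_fourier_evenCutoff j) ht0 hf hkn).trans ?_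
      rw [← hB, ← mul_assoc, ← mul_assoc]
      gcongr
      exact le_add_of_nonneg_left (by positivity)
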